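/- arXiv:1512.02537 — 3 statements merged into one kernel-verified Lean document; each statement's English description precedes it below -/
import Mathlib

section
/- Let a, b > -1 and 1 ≤ p ≤ q < ∞. The operator H_{α,β,γ}f(x) = x^α ∫₀^∞ f(y) y^β / (x+y)^γ dy is bounded from L^p((0,∞), x^a dx) to L^q((0,∞), x^b dx) if and only if γ = α + β + 1 - (a+1)/p + (b+1)/q and -p(γ-β-1) < a+1 < p(β+1). -/
open MeasureTheory Set ENNReal

/-- The measure `x^a dx` on `(0,∞)`. -/
noncomputable def wMeasure (a : ℝ) : Measure ℝ :=
  (volume.restrict (Ioi (0:ℝ))).withDensity (fun x => ENNReal.ofReal (x ^ a))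

/-- The Hilbert-type operator `H_{α,β,γ} f(x) = x^α ∫₀^∞ f(y) y^β/(x+y)^γ dy`. -/
noncomputable def Hop (α β γ : ℝ) (f : ℝ → ℝ) : ℝ → ℝ :=
  fun x => x ^ α * ∫ y in Ioi (0:ℝ), f y * y ^ β / (x + y) ^ γ


lemma wMeas_lintegral (a : ℝ) (g : ℝ → ℝ≥0∞) :
    ∫⁻ x, g x ∂(wMeasure a) = ∫⁻ x in Ioi (0:ℝ), ENNReal.ofReal (x ^ a) * g x := by
  unfold wMeasure
  rw [lintegral_withDensity_eq_lintegral_mul_non_measurable _ (by fun_prop)]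
  · rfl
  · exact Filter.Eventually.of_forall fun x => ENNReal.ofReal_lt_top

lemma wMeas_ae (a : ℝ) {P : ℝ → Prop} (h : ∀ x, 0 < x → P x) : ∀ᵐ x ∂(wMeasure a), P x := by
  unfold wMeasure
  apply (withDensity_absolutelyContinuous _ _).ae_le
  filter_upwards [ae_restrict_mem measurableSet_Ioi] with x hx using h x hx

instance wMeas_sfinite (a : ℝ) : SFinite (wMeasure a) := by
  unfold wMeasure; infer_instance

lemma wMeas_norm (a p : ℝ) (hp : 1 ≤ p) (g : ℝ → ℝ) :
    eLpNorm g (ENNReal.ofReal p) (wMeasure a) =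
      (∫⁻ x in Ioi (0:ℝ), ENNReal.ofReal (x ^ a) * ‖g x‖ₑ ^ p) ^ (1 / p) := by
  rw [eLpNorm_eq_lintegral_rpow_enorm_toReal (by simp; linarith) (by simp),
    ENNReal.toReal_ofReal (by linarith), wMeas_lintegral]

lemma wMeas_norm' (a p : ℝ) (hp : 1 ≤ p) (g : ℝ → ℝ) :
    eLpNorm g (ENNReal.ofReal p) (wMeasure a) =
      (∫⁻ x, (‖g x‖ₑ * ENNReal.ofReal (x ^ ((a + 1) / p))) ^ p ∂(wMeasure (-1))) ^ (1 / p) := by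
  rw [wMeas_norm a p hp, wMeas_lintegral]
  congr 1
  apply setLIntegral_congr_fun measurableSet_Ioi
  intro x hx
  have hx : 0 < x := hx
  have hp0 : 0 < p := by linarith
  simp only
  rw [ENNReal.mul_rpow_of_nonneg _ _ hp0.le, ENNReal.ofReal_rpow_of_pos (by positivity),
    ← Real.rpow_mul hx.le, div_mul_cancel₀ _ hp0.ne', mul_comm (‖g x‖ₑ ^ p), ← mul_assoc,
    ← ENNReal.ofReal_mul (by positivity), ← Real.rpow_add hx]
  congr 3
  ring_nf

/-- Jensen / Hölder. -/
lemma jensen_aux {X : Type*} [MeasurableSpace X] (ν : Measure X) (p : ℝ) (hp : 1 ≤ p)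
    (k F : X → ℝ≥0∞) (hk : Measurable k) (hF : Measurable F) :
    (∫⁻ y, k y * F y ∂ν) ^ p ≤ (∫⁻ y, k y ∂ν) ^ (p - 1) * ∫⁻ y, k y * F y ^ p ∂ν := by
  have hp0 : 0 < p := by linarith
  have h := ENNReal.lintegral_mul_norm_pow_le (μ := ν) (f := k) (g := fun y => k y * F y ^ p)
    hk.aemeasurable (by fun_prop) (p := 1 - 1 / p) (q := 1 / p)
    (by rw [sub_nonneg, div_le_one hp0]; exact hp) (by positivity) (by ring)
  have e : ∀ y, k y ^ (1 - 1 / p) * (k y * F y ^ p) ^ (1 / p) = k y * F y := by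
    intro y
    rw [ENNReal.mul_rpow_of_nonneg _ _ (by positivity), ← ENNReal.rpow_mul,
      mul_one_div_cancel hp0.ne', ENNReal.rpow_one, ← mul_assoc,
      ← ENNReal.rpow_add_of_nonneg _ _ (by rw [sub_nonneg, div_le_one hp0]; exact hp)
        (by positivity)]
    simp
  simp only [e] at h
  calc _ ≤ _ := ENNReal.rpow_le_rpow h hp0.le
    _ = _ := by
      rw [ENNReal.mul_rpow_of_nonneg _ _ hp0.le, ← ENNReal.rpow_mul, ← ENNReal.rpow_mul,
        one_div_mul_cancel hp0.ne', ENNReal.rpow_one]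
      congr 2
      field_simp

/-- Young-type inequality. -/
lemma schur_aux {X : Type*} [MeasurableSpace X] (ν : Measure X) [SFinite ν] (p q : ℝ) (hp : 1 ≤ p)
    (hpq : p ≤ q) (k : X → X → ℝ≥0∞) (hk : Measurable (Function.uncurry k)) (I : ℝ≥0∞)
    (h1 : ∀ᵐ x ∂ν, ∀ᵐ y ∂ν, k x y ≤ 1) (hI : I ≠ ⊤)
    (hI1 : ∀ᵐ x ∂ν, ∫⁻ y, k x y ∂ν ≤ I) (hI2 : ∀ᵐ y ∂ν, ∫⁻ x, k x y ∂ν ≤ I)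
    (F : X → ℝ≥0∞) (hF : Measurable F) :
    (∫⁻ x, (∫⁻ y, k x y * F y ∂ν) ^ q ∂ν) ^ (1 / q) ≤
      ((I ^ (p - 1)) ^ (q / p) * I) ^ (1 / q) * (∫⁻ y, F y ^ p ∂ν) ^ (1 / p) := by
  have hp0 : 0 < p := by linarith
  have hq0 : 0 < q := by linarith
  have hqp : 1 ≤ q / p := by rwa [one_le_div hp0]
  set N := ∫⁻ y, F y ^ p ∂ν with hN
  have hIp : I ^ (p - 1) ≠ ⊤ := ENNReal.rpow_ne_top_of_nonneg (by linarith) hI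
  have hpt : ∀ᵐ x ∂ν, (∫⁻ y, k x y * F y ∂ν) ^ q ≤
      (I ^ (p - 1)) ^ (q / p) * N ^ (q / p - 1) * ∫⁻ y, k x y * F y ^ p ∂ν := by
    filter_upwards [h1, hI1] with x hx1 hx2
    have hkx : Measurable (k x) := hk.of_uncurry_left
    set J := ∫⁻ y, k x y * F y ^ p ∂ν with hJ
    have hJN : J ≤ N := by
      apply lintegral_mono_ae
      filter_upwards [hx1] with y hy
      exact mul_le_of_le_one_left' hy
    have h2 : (∫⁻ y, k x y * F y ∂ν) ^ p ≤ I ^ (p - 1) * J :=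
      (jensen_aux ν p hp (k x) F hkx hF).trans
        (by gcongr)
    calc (∫⁻ y, k x y * F y ∂ν) ^ q = ((∫⁻ y, k x y * F y ∂ν) ^ p) ^ (q / p) := by
          rw [← ENNReal.rpow_mul, mul_div_cancel₀ _ hp0.ne']
      _ ≤ (I ^ (p - 1) * J) ^ (q / p) := ENNReal.rpow_le_rpow h2 (by positivity)
      _ = (I ^ (p - 1)) ^ (q / p) * (J ^ (q / p - 1) * J ^ (1:ℝ)) := by
          rw [ENNReal.mul_rpow_of_nonneg _ _ (by positivity),
            ← ENNReal.rpow_add_of_nonneg _ _ (by linarith) (by norm_num)]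
          simp
      _ ≤ (I ^ (p - 1)) ^ (q / p) * (N ^ (q / p - 1) * J) := by
          rw [ENNReal.rpow_one]
          gcongr
      _ = _ := by ring
  have hswap : ∫⁻ x, ∫⁻ y, k x y * F y ^ p ∂ν ∂ν ≤ I * N := by
    rw [lintegral_lintegral_swap]
    · calc _ ≤ ∫⁻ y, I * F y ^ p ∂ν := by
            apply lintegral_mono_ae
            filter_upwards [hI2] with y hy
            rw [lintegral_mul_const _ (hk.of_uncurry_right)]
            gcongr
        _ = _ := by rw [lintegral_const_mul _ (by fun_prop)]
    · apply Measurable.aemeasurable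
      exact hk.mul ((hF.comp measurable_snd).pow_const p)
  have hmeas : Measurable fun x => ∫⁻ y, k x y * F y ^ p ∂ν := by
    apply Measurable.lintegral_prod_right'
      (f := fun z : X × X => k z.1 z.2 * F z.2 ^ p)
    exact hk.mul ((hF.comp measurable_snd).pow_const p)
  calc _ ≤ ((I ^ (p - 1)) ^ (q / p) * N ^ (q / p - 1) * (I * N)) ^ (1 / q) := by
        apply ENNReal.rpow_le_rpow _ (by positivity)
        refine (lintegral_mono_ae hpt).trans ?_
        rw [lintegral_const_mul _ hmeas]
        gcongr
    _ = ((I ^ (p - 1)) ^ (q / p) * I * (N ^ (q / p - 1) * N ^ (1:ℝ))) ^ (1 / q) := by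
        rw [ENNReal.rpow_one]; congr 1; ring
    _ = _ := by
        rw [← ENNReal.rpow_add_of_nonneg _ _ (by linarith) (by norm_num), sub_add_cancel,
          ENNReal.mul_rpow_of_nonneg _ _ (by positivity), ← ENNReal.rpow_mul N]
        congr 2
        field_simp

noncomputable def kK (A B : ℝ) (x y : ℝ) : ℝ≥0∞ :=
  ENNReal.ofReal (x ^ A * y ^ B / (x + y) ^ (A + B))

lemma kK_symm (A B x y : ℝ) : kK A B x y = kK B A y x := by
  unfold kK; rw [mul_comm, add_comm x, add_comm A]

lemma kK_le1 {A B : ℝ} (hA : 0 < A) (hB : 0 < B) {x y : ℝ} (hx : 0 < x) (hy : 0 < y) :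
    x ^ A * y ^ B / (x + y) ^ (A + B) ≤ x ^ (-B) * y ^ B := by
  have : x ^ (-B) = x ^ A / x ^ (A + B) := by rw [← Real.rpow_sub hx]; congr 1; ring
  rw [this, div_mul_eq_mul_div]
  gcongr
  linarith

lemma kK_le2 {A B : ℝ} (hA : 0 < A) (hB : 0 < B) {x y : ℝ} (hx : 0 < x) (hy : 0 < y) :
    x ^ A * y ^ B / (x + y) ^ (A + B) ≤ x ^ A * y ^ (-A) := by
  have := kK_le1 hB hA hy hx
  rwa [mul_comm, add_comm y, add_comm B, mul_comm (y ^ (-A))] at this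

lemma kK_le_one {A B : ℝ} (hA : 0 < A) (hB : 0 < B) {x y : ℝ} (hx : 0 < x) (hy : 0 < y) :
    kK A B x y ≤ 1 := by
  unfold kK
  rw [ENNReal.ofReal_le_one, div_le_one (by positivity), Real.rpow_add (by positivity)]
  gcongr <;> linarith

lemma kK_marg {A B : ℝ} (hA : 0 < A) (hB : 0 < B) {x : ℝ} (hx : 0 < x) :
    ∫⁻ y, kK A B x y ∂(wMeasure (-1)) ≤ ENNReal.ofReal (1 / B) + ENNReal.ofReal (1 / A) := by
  rw [wMeas_lintegral, ← Ioc_union_Ioi_eq_Ioi hx.le]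
  refine (lintegral_union_le _ _ _).trans ?_
  unfold kK
  gcongr
  · have hi : IntegrableOn (fun y : ℝ => x ^ (-B) * y ^ (B - 1)) (Ioc 0 x) := by
      apply Integrable.const_mul
      have := intervalIntegral.intervalIntegrable_rpow' (a := 0) (b := x) (r := B - 1) (by linarith)
      rwa [intervalIntegrable_iff_integrableOn_Ioc_of_le hx.le] at this
    calc _ ≤ ∫⁻ y in Ioc 0 x, ENNReal.ofReal (x ^ (-B) * y ^ (B - 1)) := by
          apply setLIntegral_mono (by fun_prop)
          intro y hy
          have hy0 : 0 < y := hy.1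
          rw [← ENNReal.ofReal_mul (by positivity)]
          apply ENNReal.ofReal_le_ofReal
          calc _ ≤ y ^ (-1:ℝ) * (x ^ (-B) * y ^ B) := by
                gcongr; exact kK_le1 hA hB hx hy0
            _ = _ := by
              rw [sub_eq_add_neg, Real.rpow_add hy0]; ring
      _ = ENNReal.ofReal (∫ y in Ioc 0 x, x ^ (-B) * y ^ (B - 1)) := by
          rw [ofReal_integral_eq_lintegral_ofReal hi]
          filter_upwards [ae_restrict_mem measurableSet_Ioc] with y hy
          have hy0 : 0 < y := hy.1
          simp only [Pi.zero_apply]; positivity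
      _ ≤ _ := by
          apply ENNReal.ofReal_le_ofReal
          rw [integral_const_mul, ← intervalIntegral.integral_of_le hx.le,
            integral_rpow (Or.inl (by linarith)), sub_add_cancel, Real.zero_rpow hB.ne', sub_zero,
            ← mul_div_assoc, ← Real.rpow_add hx]
          simp
  · have hi : IntegrableOn (fun y : ℝ => x ^ A * y ^ (-A - 1)) (Ioi x) := by
      apply Integrable.const_mul
      exact (integrableOn_Ioi_rpow_iff hx).2 (by linarith)
    calc _ ≤ ∫⁻ y in Ioi x, ENNReal.ofReal (x ^ A * y ^ (-A - 1)) := by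
          apply setLIntegral_mono (by fun_prop)
          intro y hy
          have hy0 : 0 < y := hx.trans hy
          rw [← ENNReal.ofReal_mul (by positivity)]
          apply ENNReal.ofReal_le_ofReal
          calc _ ≤ y ^ (-1:ℝ) * (x ^ A * y ^ (-A)) := by
                gcongr; exact kK_le2 hA hB hx hy0
            _ = _ := by
              rw [sub_eq_add_neg (-A), Real.rpow_add hy0]; ring
      _ = ENNReal.ofReal (∫ y in Ioi x, x ^ A * y ^ (-A - 1)) := by
          rw [ofReal_integral_eq_lintegral_ofReal hi]
          filter_upwards [ae_restrict_mem measurableSet_Ioi] with y hy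
          have hy0 : 0 < y := hx.trans hy
          simp only [Pi.zero_apply]; positivity
      _ ≤ _ := by
          apply ENNReal.ofReal_le_ofReal
          rw [integral_const_mul, integral_Ioi_rpow_of_lt (by linarith) hx, sub_add_cancel,
            neg_div_neg_eq, ← mul_div_assoc, ← Real.rpow_add hx]
          simp

lemma suff_part (a b p q α β γ : ℝ) (hp : 1 ≤ p) (hpq : p ≤ q)
    (hγ : γ = α + β + 1 - (a + 1) / p + (b + 1) / q)
    (h1 : -p * (γ - β - 1) < a + 1) (h2 : a + 1 < p * (β + 1)) :
    ∃ C : ℝ≥0∞, C ≠ ⊤ ∧ ∀ f : ℝ → ℝ, Measurable f →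
        eLpNorm (Hop α β γ f) (ENNReal.ofReal q) (wMeasure b)
          ≤ C * eLpNorm f (ENNReal.ofReal p) (wMeasure a) := by
  have hp0 : 0 < p := by linarith
  have hq0 : 0 < q := by linarith
  obtain ⟨A, hAd⟩ : ∃ A, A = α + (b + 1) / q := ⟨_, rfl⟩
  obtain ⟨B, hBd⟩ : ∃ B, B = β + 1 - (a + 1) / p := ⟨_, rfl⟩
  have hAB : γ = A + B := by rw [hγ, hAd, hBd]; ring
  have hB : 0 < B := by
    rw [hBd, sub_pos, div_lt_iff₀ hp0]; linarith
  have hA : 0 < A := by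
    have : A = (a + 1) / p - (-(γ - β - 1)) := by rw [hAB, hBd]; ring
    rw [this, sub_pos, lt_div_iff₀ hp0]; linarith
  set I := ENNReal.ofReal (1 / B) + ENNReal.ofReal (1 / A) with hI
  have hIt : I ≠ ⊤ := by simp [hI]
  refine ⟨((I ^ (p - 1)) ^ (q / p) * I) ^ (1 / q), ?_, ?_⟩
  · apply ENNReal.rpow_ne_top_of_nonneg (by positivity)
    apply ENNReal.mul_ne_top _ hIt
    apply ENNReal.rpow_ne_top_of_nonneg (by positivity)
    exact ENNReal.rpow_ne_top_of_nonneg (by linarith) hIt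
  intro f hf
  rw [wMeas_norm' a p hp f, wMeas_norm' b q (hp.trans hpq)]
  refine le_trans ?_ (schur_aux (wMeasure (-1)) p q hp hpq (kK A B) ?_ I ?_ hIt ?_ ?_ _ ?_)
  · apply ENNReal.rpow_le_rpow _ (by positivity)
    apply lintegral_mono_ae
    apply wMeas_ae
    intro x hx
    apply ENNReal.rpow_le_rpow _ hq0.le
    rw [wMeas_lintegral]
    unfold Hop
    rw [enorm_mul]
    calc _ ≤ ‖x ^ α‖ₑ * (∫⁻ y in Ioi (0:ℝ), ‖f y * y ^ β / (x + y) ^ γ‖ₑ) *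
            ENNReal.ofReal (x ^ ((b + 1) / q)) := by
          gcongr; exact enorm_integral_le_lintegral_enorm _
      _ = ∫⁻ y in Ioi (0:ℝ), ENNReal.ofReal (x ^ A) * ‖f y * y ^ β / (x + y) ^ γ‖ₑ := by
          rw [lintegral_const_mul _ (by fun_prop), hAd, Real.rpow_add hx,
            ENNReal.ofReal_mul (by positivity), Real.enorm_of_nonneg (by positivity)]
          ring
      _ ≤ _ := by
          apply le_of_eq
          apply setLIntegral_congr_fun measurableSet_Ioi
          intro y hy
          have hy : 0 < y := hy
          simp only
          unfold kK
          rw [mul_div_assoc, enorm_mul, Real.enorm_of_nonneg (r := y ^ β / (x + y) ^ γ)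
            (by positivity), mul_comm ‖f y‖ₑ, ← mul_assoc, ← ENNReal.ofReal_mul (by positivity),
            mul_comm ‖f y‖ₑ, ← mul_assoc, ← mul_assoc,
            ← ENNReal.ofReal_mul (by positivity), ← ENNReal.ofReal_mul (by positivity)]
          congr 2
          have : y ^ β = y ^ (-1:ℝ) * y ^ B * y ^ ((a + 1) / p) := by
            rw [← Real.rpow_add hy, ← Real.rpow_add hy, hBd]; congr 1; ring
          rw [this, hAB]; ring
  · unfold kK Function.uncurry; fun_prop
  · exact wMeas_ae _ fun x hx => wMeas_ae _ fun y hy => kK_le_one hA hB hx hy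
  · exact wMeas_ae _ fun x hx => kK_marg hA hB hx
  · apply wMeas_ae _ fun y hy => ?_
    simp_rw [kK_symm A B]
    rw [hI, add_comm]
    exact kK_marg hB hA hy
  · fun_prop

lemma rpow_low (s : ℝ) {u v : ℝ} (hu : 0 < u) (h1 : u ≤ v) (h2 : v ≤ 4 * u) :
    min 1 ((4:ℝ) ^ s) * u ^ s ≤ v ^ s := by
  have hus : 0 < u ^ s := by positivity
  rcases le_total 0 s with hs | hs
  · calc _ ≤ 1 * u ^ s := by gcongr; exact min_le_left _ _
      _ ≤ _ := by rw [one_mul]; gcongr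
  · calc _ ≤ (4:ℝ) ^ s * u ^ s := by gcongr; exact min_le_right _ _
      _ = (4 * u) ^ s := by rw [Real.mul_rpow (by norm_num) hu.le]
      _ ≤ _ := Real.rpow_le_rpow_of_nonpos (by linarith) h2 hs

lemma rpow_up (s : ℝ) {u v : ℝ} (hu : 0 < u) (h1 : u ≤ v) (h2 : v ≤ 4 * u) :
    v ^ s ≤ max 1 ((4:ℝ) ^ s) * u ^ s := by
  have hus : 0 < u ^ s := by positivity
  rcases le_total 0 s with hs | hs
  · calc _ ≤ (4 * u) ^ s := by gcongr; linarith
      _ = (4:ℝ) ^ s * u ^ s := by rw [Real.mul_rpow (by norm_num) hu.le]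
      _ ≤ _ := by gcongr; exact le_max_right _ _
  · calc _ ≤ u ^ s := Real.rpow_le_rpow_of_nonpos hu h1 hs
      _ = 1 * u ^ s := by rw [one_mul]
      _ ≤ _ := by gcongr; exact le_max_left _ _

lemma cc_pos (s : ℝ) : 0 < min 1 ((4:ℝ) ^ s) := lt_min one_pos (by positivity)

lemma wMeas_Icc (a : ℝ) {t : ℝ} (ht : 0 < t) :
    wMeasure a (Icc t (2 * t)) = ∫⁻ x in Icc t (2 * t), ENNReal.ofReal (x ^ a) := by
  unfold wMeasure
  rw [withDensity_apply _ measurableSet_Icc, Measure.restrict_restrict measurableSet_Icc,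
    inter_eq_left.2]
  intro x hx
  exact ht.trans_le hx.1

lemma wMeas_Icc_up (a : ℝ) {t : ℝ} (ht : 0 < t) :
    wMeasure a (Icc t (2 * t)) ≤ ENNReal.ofReal (max 1 ((4:ℝ) ^ a) * t ^ (a + 1)) := by
  rw [wMeas_Icc a ht]
  calc _ ≤ ∫⁻ x in Icc t (2 * t), ENNReal.ofReal (max 1 ((4:ℝ) ^ a) * t ^ a) := by
        apply setLIntegral_mono (by fun_prop)
        intro x hx
        apply ENNReal.ofReal_le_ofReal
        exact rpow_up a ht hx.1 (by linarith [hx.2])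
    _ = _ := by
        rw [setLIntegral_const, Real.volume_Icc, ← ENNReal.ofReal_mul (by positivity),
          Real.rpow_add ht, Real.rpow_one]
        congr 1; ring

lemma wMeas_Icc_low (a : ℝ) {t : ℝ} (ht : 0 < t) :
    ENNReal.ofReal (min 1 ((4:ℝ) ^ a) * t ^ (a + 1)) ≤ wMeasure a (Icc t (2 * t)) := by
  rw [wMeas_Icc a ht]
  have := cc_pos a
  calc _ = ∫⁻ x in Icc t (2 * t), ENNReal.ofReal (min 1 ((4:ℝ) ^ a) * t ^ a) := by
        rw [setLIntegral_const, Real.volume_Icc, ← ENNReal.ofReal_mul (by positivity),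
          Real.rpow_add ht, Real.rpow_one]
        congr 1; ring
    _ ≤ _ := by
        apply setLIntegral_mono (by fun_prop)
        intro x hx
        apply ENNReal.ofReal_le_ofReal
        exact rpow_low a ht hx.1 (by linarith [hx.2])

lemma Hop_low (α β γ : ℝ) {t x u : ℝ} (ht : 0 < t) (hx : 0 < x) (hu : 0 < u)
    (h1 : u ≤ x + t) (h2 : x + 2 * t ≤ 4 * u) :
    (min 1 ((4:ℝ) ^ β) * min 1 ((4:ℝ) ^ (-γ))) * (x ^ α * t ^ (β + 1) * u ^ (-γ)) ≤
      Hop α β γ ((Icc t (2 * t)).indicator fun _ => 1) x := by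
  unfold Hop
  have hc1 := cc_pos β
  have hc2 := cc_pos (-γ)
  have e : ∫ y in Ioi (0:ℝ), ((Icc t (2 * t)).indicator (fun _ => (1:ℝ)) y) * y ^ β / (x + y) ^ γ
      = ∫ y in Icc t (2 * t), y ^ β * (x + y) ^ (-γ) := by
    have : ∀ y ∈ Ioi (0:ℝ),
        ((Icc t (2 * t)).indicator (fun _ => (1:ℝ)) y) * y ^ β / (x + y) ^ γ =
        (Icc t (2 * t)).indicator (fun y => y ^ β * (x + y) ^ (-γ)) y := by
      intro y hy
      have hy : 0 < y := hy
      by_cases h : y ∈ Icc t (2 * t)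
      · rw [indicator_of_mem h, indicator_of_mem h, Real.rpow_neg (by positivity)]
        ring
      · simp [indicator_of_notMem h]
    rw [setIntegral_congr_fun measurableSet_Ioi this, setIntegral_indicator measurableSet_Icc,
      inter_eq_right.2]
    intro y hy
    exact ht.trans_le hy.1
  rw [e]
  have hcont : ContinuousOn (fun y : ℝ => y ^ β * (x + y) ^ (-γ)) (Icc t (2 * t)) := by
    intro y hy
    have hy0 : 0 < y := ht.trans_le hy.1
    apply ContinuousAt.continuousWithinAt
    apply ContinuousAt.mul
    · exact Real.continuousAt_rpow_const _ _ (Or.inl hy0.ne')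
    · exact ContinuousAt.rpow_const (by fun_prop) (Or.inl (by positivity))
  have hlow : (min 1 ((4:ℝ) ^ β) * t ^ β) * (min 1 ((4:ℝ) ^ (-γ)) * u ^ (-γ)) * t ≤
      ∫ y in Icc t (2 * t), y ^ β * (x + y) ^ (-γ) := by
    calc _ = ∫ y in Icc t (2 * t),
          (min 1 ((4:ℝ) ^ β) * t ^ β) * (min 1 ((4:ℝ) ^ (-γ)) * u ^ (-γ)) := by
          rw [setIntegral_const, Measure.real, Real.volume_Icc,
            ENNReal.toReal_ofReal (by linarith), smul_eq_mul]
          ring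
      _ ≤ _ := by
          apply setIntegral_mono_on _ hcont.integrableOn_Icc measurableSet_Icc
          · intro y hy
            have hy0 : 0 < y := ht.trans_le hy.1
            apply mul_le_mul
            · exact rpow_low β ht hy.1 (by linarith [hy.2])
            · exact rpow_low (-γ) hu (by linarith [hy.1]) (by linarith [hy.2])
            · positivity
            · positivity
          · exact continuousOn_const.integrableOn_Icc
  calc _ = x ^ α * ((min 1 ((4:ℝ) ^ β) * t ^ β) * (min 1 ((4:ℝ) ^ (-γ)) * u ^ (-γ)) * t) := by
        rw [Real.rpow_add ht, Real.rpow_one]; ring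
    _ ≤ _ := by gcongr

lemma exp_zero {e D : ℝ} (h : ∀ t : ℝ, 0 < t → t ^ e ≤ D) : e = 0 := by
  by_contra he
  have h1 : (0:ℝ) < |D| + 1 := by positivity
  have := h ((|D| + 1) ^ (1 / e)) (by positivity)
  rw [← Real.rpow_mul h1.le, one_div_mul_cancel he, Real.rpow_one] at this
  linarith [le_abs_self D]

lemma integ_aux (S : Set ℝ) (hS : MeasurableSet S) (hS0 : S ⊆ Ioi 0) (c s q b : ℝ) (hc : 0 < c)
    (hq : 0 < q) (g : ℝ → ℝ) (hg : ∀ x ∈ S, c * x ^ s ≤ g x)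
    (hfin : ∫⁻ x in Ioi (0:ℝ), ENNReal.ofReal (x ^ b) * ‖g x‖ₑ ^ q ≠ ⊤) :
    IntegrableOn (fun x : ℝ => x ^ (s * q + b)) S := by
  have hle : ∫⁻ x in S, ENNReal.ofReal (c ^ q) * ENNReal.ofReal (x ^ (s * q + b)) ≤
      ∫⁻ x in Ioi (0:ℝ), ENNReal.ofReal (x ^ b) * ‖g x‖ₑ ^ q := by
    calc _ ≤ ∫⁻ x in S, ENNReal.ofReal (x ^ b) * ‖g x‖ₑ ^ q := by
          apply lintegral_mono_ae
          filter_upwards [ae_restrict_mem hS] with x hx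
          have hx0 : 0 < x := hS0 hx
          have hgx : 0 < g x := lt_of_lt_of_le (by positivity) (hg x hx)
          rw [Real.enorm_of_nonneg hgx.le, ENNReal.ofReal_rpow_of_pos hgx,
            ← ENNReal.ofReal_mul (by positivity), ← ENNReal.ofReal_mul (by positivity)]
          apply ENNReal.ofReal_le_ofReal
          calc _ = x ^ b * (c * x ^ s) ^ q := by
                rw [Real.mul_rpow hc.le (by positivity), ← Real.rpow_mul hx0.le,
                  Real.rpow_add hx0]
                ring
            _ ≤ _ := by
                have := hg x hx
                gcongr
      _ ≤ _ := lintegral_mono_set hS0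
  rw [lintegral_const_mul _ (by fun_prop)] at hle
  have h2 : ∫⁻ x in S, ENNReal.ofReal (x ^ (s * q + b)) ≠ ⊤ := by
    intro h
    rw [h, ENNReal.mul_top (by simp; positivity)] at hle
    exact hfin (top_le_iff.1 hle)
  refine ⟨by fun_prop, ?_⟩
  rw [hasFiniteIntegral_iff_ofReal]
  · exact h2.lt_top
  · filter_upwards [ae_restrict_mem hS] with x hx
    have hx0 : 0 < x := hS0 hx
    simp only [Pi.zero_apply]; positivity

lemma nec_part (a b p q α β γ : ℝ) (hp : 1 ≤ p) (hpq : p ≤ q)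
    (C : ℝ≥0∞) (hC : C ≠ ⊤) (h : ∀ f : ℝ → ℝ, Measurable f →
        eLpNorm (Hop α β γ f) (ENNReal.ofReal q) (wMeasure b)
          ≤ C * eLpNorm f (ENNReal.ofReal p) (wMeasure a)) :
    (γ = α + β + 1 - (a + 1) / p + (b + 1) / q ∧
          -p * (γ - β - 1) < a + 1 ∧ a + 1 < p * (β + 1)) := by
  have hp0 : 0 < p := by linarith
  have hq0 : 0 < q := by linarith
  have hq1 : 1 ≤ q := by linarith
  have hpe : ENNReal.ofReal p ≠ 0 := by simpa using hp0
  have hqe : ENNReal.ofReal q ≠ 0 := by simpa using hq0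
  set c := min 1 ((4:ℝ) ^ β) * min 1 ((4:ℝ) ^ (-γ)) with hc
  have hc0 : 0 < c := mul_pos (cc_pos _) (cc_pos _)
  have hca := cc_pos α
  have hcb := cc_pos b
  have hm : ∀ t : ℝ, Measurable ((Icc t (2 * t)).indicator fun _ => (1:ℝ)) := fun t =>
    measurable_const.indicator measurableSet_Icc
  have hup : ∀ t : ℝ, 0 < t → eLpNorm (Hop α β γ ((Icc t (2 * t)).indicator fun _ => (1:ℝ)))
      (ENNReal.ofReal q) (wMeasure b) ≤
      C * ENNReal.ofReal (max 1 ((4:ℝ) ^ a) * t ^ (a + 1)) ^ (1 / p) := by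
    intro t ht
    refine (h _ (hm t)).trans ?_
    rw [eLpNorm_indicator_const measurableSet_Icc hpe ENNReal.ofReal_ne_top,
      ENNReal.toReal_ofReal hp0.le]
    simp only [enorm_one, one_mul]
    gcongr
    exact wMeas_Icc_up a ht
  -- homogeneity
  have hhom : α + β + 1 - γ + (b + 1) / q - (a + 1) / p = 0 := by
    set D := C.toReal * (max 1 ((4:ℝ) ^ a)) ^ (1 / p) /
      (c * min 1 ((4:ℝ) ^ α) * (min 1 ((4:ℝ) ^ b)) ^ (1 / q)) with hD
    apply exp_zero (D := D)
    intro t ht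
    set L := c * min 1 ((4:ℝ) ^ α) * t ^ (α + β + 1 - γ) with hL
    have hL0 : 0 < L := by positivity
    have hlow : ENNReal.ofReal L * ENNReal.ofReal (min 1 ((4:ℝ) ^ b) * t ^ (b + 1)) ^ (1 / q) ≤
        eLpNorm (Hop α β γ ((Icc t (2 * t)).indicator fun _ => (1:ℝ)))
      (ENNReal.ofReal q) (wMeasure b) := by
      calc _ ≤ eLpNorm ((Icc t (2 * t)).indicator fun _ => L) (ENNReal.ofReal q) (wMeasure b) := by
            rw [eLpNorm_indicator_const measurableSet_Icc hqe ENNReal.ofReal_ne_top,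
              ENNReal.toReal_ofReal hq0.le, Real.enorm_of_nonneg hL0.le]
            gcongr
            exact wMeas_Icc_low b ht
        _ ≤ _ := by
            apply eLpNorm_mono_enorm_ae
            apply Filter.Eventually.of_forall
            intro x
            by_cases hx : x ∈ Icc t (2 * t)
            · rw [indicator_of_mem hx]
              have hx0 : 0 < x := ht.trans_le hx.1
              have h1 := Hop_low α β γ ht hx0 ht (by linarith) (by linarith [hx.2])
              have h2 : L ≤ Hop α β γ ((Icc t (2 * t)).indicator fun _ => (1:ℝ)) x := by
                refine le_trans ?_ h1
                have h3 := rpow_low α ht hx.1 (by linarith [hx.2])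
                calc L = c * ((min 1 ((4:ℝ) ^ α) * t ^ α) * t ^ (β + 1) * t ^ (-γ)) := by
                      rw [hL, show α + β + 1 - γ = α + (β + 1) + -γ by ring, Real.rpow_add ht,
                        Real.rpow_add ht]
                      ring
                  _ ≤ _ := by gcongr
              rw [Real.enorm_of_nonneg hL0.le, Real.enorm_of_nonneg (hL0.le.trans h2)]
              exact ENNReal.ofReal_le_ofReal h2
            · simp [indicator_of_notMem hx]
    have hfin := hlow.trans (hup t ht)
    rw [← ENNReal.ofReal_toReal hC, ENNReal.ofReal_rpow_of_pos (by positivity),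
      ENNReal.ofReal_rpow_of_pos (by positivity), ← ENNReal.ofReal_mul hL0.le,
      ← ENNReal.ofReal_mul (by positivity), ENNReal.ofReal_le_ofReal_iff (by positivity),
      Real.mul_rpow (by positivity) (by positivity), Real.mul_rpow (by positivity) (by positivity),
      ← Real.rpow_mul ht.le, ← Real.rpow_mul ht.le, mul_one_div, mul_one_div] at hfin
    rw [hD, le_div_iff₀ (by positivity), Real.rpow_sub ht, Real.rpow_add ht, div_mul_eq_mul_div,
      div_le_iff₀ (by positivity)]
    rw [hL] at hfin
    linarith
  have hfin : ∫⁻ x in Ioi (0:ℝ), ENNReal.ofReal (x ^ b) *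
      ‖Hop α β γ ((Icc 1 (2 * 1)).indicator fun _ => (1:ℝ)) x‖ₑ ^ q ≠ ⊤ := by
    intro htop
    have := hup 1 one_pos
    rw [wMeas_norm b q hq1, htop, ENNReal.top_rpow_of_pos (by positivity), top_le_iff] at this
    refine ENNReal.mul_ne_top hC ?_ this
    exact ENNReal.rpow_ne_top_of_nonneg (by positivity) ENNReal.ofReal_ne_top
  have i1 := integ_aux (Ioo 0 1) measurableSet_Ioo (fun x hx => hx.1) c α q b hc0 hq0 _
    (fun x hx => by
      have := Hop_low α β γ one_pos hx.1 one_pos (by linarith [hx.1]) (by linarith [hx.2])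
      simpa using this) hfin
  have i2 := integ_aux (Ioi 1) measurableSet_Ioi
    (Ioi_subset_Ioi zero_le_one) c (α - γ) q b hc0 hq0 _
    (fun x hx => by
      have hx1 : 1 < x := hx
      have hx0 : 0 < x := one_pos.trans hx
      have := Hop_low α β γ one_pos hx0 hx0 (by linarith) (by linarith)
      rw [sub_eq_add_neg, Real.rpow_add hx0]
      simpa using this) hfin
  rw [intervalIntegral.integrableOn_Ioo_rpow_iff one_pos] at i1
  rw [integrableOn_Ioi_rpow_iff one_pos] at i2
  have hA : 0 < α + (b + 1) / q := by
    have : α + (b + 1) / q = (α * q + b + 1) / q := by field_simp; ring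
    rw [this]; apply div_pos <;> linarith
  have hB : 0 < γ - α - (b + 1) / q := by
    have : γ - α - (b + 1) / q = (-((α - γ) * q + b + 1)) / q := by field_simp; ring
    rw [this]; apply div_pos <;> linarith
  refine ⟨by linarith, ?_, ?_⟩
  · have : -(γ - β - 1) < (a + 1) / p := by linarith
    rw [lt_div_iff₀ hp0] at this; linarith
  · have : (a + 1) / p < β + 1 := by linarith
    rw [div_lt_iff₀ hp0] at this; linarith

theorem stmt_6 (a b p q α β γ : ℝ) (ha : -1 < a) (hb : -1 < b) (hp : 1 ≤ p) (hpq : p ≤ q) :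
    (∃ C : ℝ≥0∞, C ≠ ⊤ ∧ ∀ f : ℝ → ℝ, Measurable f →
        eLpNorm (Hop α β γ f) (ENNReal.ofReal q) (wMeasure b)
          ≤ C * eLpNorm f (ENNReal.ofReal p) (wMeasure a))
      ↔ (γ = α + β + 1 - (a + 1) / p + (b + 1) / q ∧
          -p * (γ - β - 1) < a + 1 ∧ a + 1 < p * (β + 1)) := by
  constructor
  · rintro ⟨C, hC, h⟩
    exact nec_part a b p q α β γ hp hpq C hC h
  · rintro ⟨h1, h2, h3⟩
    exact suff_part a b p q α β γ hp hpq h1 h2 h3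
end

section
/- Let 1 < p ≤ q < ∞, a, b > -1, and suppose γ = α + β + 1 - (a+1)/p + (b+1)/q and -p(γ-β-1) < a+1 < p(β+1). Then H_{α,β,γ}f(x) = x^α ∫₀^∞ f(y) y^β/(x+y)^γ dy defines a bounded operator from L^p((0,∞), y^a dy) to L^q((0,∞), y^b dy). -/
open MeasureTheory Set ENNReal

theorem schur_aux_s9 (ν : Measure ℝ) [SFinite ν] (K : ℝ → ℝ → ℝ≥0∞)
    (hK : Measurable (Function.uncurry K)) (A : ℝ≥0∞) (p q : ℝ) (hp : 1 < p) (hpq : p ≤ q)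
    (hK1 : ∀ᵐ x ∂ν, ∀ᵐ y ∂ν, K x y ≤ 1)
    (hA : ∀ᵐ x ∂ν, ∫⁻ y, K x y ∂ν ≤ A) (hB : ∀ᵐ y ∂ν, ∫⁻ x, K x y ∂ν ≤ A)
    (g : ℝ → ℝ≥0∞) (hg : Measurable g) :
    ∫⁻ x, (∫⁻ y, K x y * g y ∂ν) ^ q ∂ν
      ≤ A ^ ((p - 1) * (q / p)) * A * (∫⁻ y, g y ^ p ∂ν) ^ (q / p) := by
  have hp0 : 0 < p := by linarith
  have hqp : 1 ≤ q / p := by rw [le_div_iff₀ hp0]; linarith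
  set N := ∫⁻ y, g y ^ p ∂ν with hN
  have hKx : ∀ x, Measurable (K x) := fun x => hK.comp measurable_prodMk_left
  have hKg : Measurable (Function.uncurry fun x y => K x y * g y ^ p) :=
    hK.mul ((hg.comp measurable_snd).pow_const p)
  have key : ∀ᵐ x ∂ν, (∫⁻ y, K x y * g y ∂ν) ^ q
      ≤ A ^ ((p - 1) * (q / p)) * N ^ (q / p - 1) * ∫⁻ y, K x y * g y ^ p ∂ν := by
    filter_upwards [hK1, hA] with x hx1 hxA
    set I := ∫⁻ y, K x y * g y ^ p ∂ν with hI
    have hIN : I ≤ N := by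
      apply lintegral_mono_ae
      filter_upwards [hx1] with y hy
      calc K x y * g y ^ p ≤ 1 * g y ^ p := by gcongr
        _ = _ := one_mul _
    have hc : (p / (p - 1)).HolderConjugate p := (Real.HolderConjugate.conjExponent hp).symm
    have h := ENNReal.lintegral_mul_le_Lp_mul_Lq ν hc
      (f := fun y => K x y ^ ((p - 1) / p)) (g := fun y => K x y ^ (1 / p) * g y)
      ((hKx x).pow_const _).aemeasurable (((hKx x).pow_const _).mul hg).aemeasurable
    have e1 : ∀ y, ((fun y => K x y ^ ((p - 1) / p)) * (fun y => K x y ^ (1 / p) * g y)) y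
        = K x y * g y := by
      intro y
      simp only [Pi.mul_apply]
      rw [← mul_assoc, ← ENNReal.rpow_add_of_nonneg _ _ (by apply div_nonneg <;> linarith) (by positivity)]
      rw [← add_div, sub_add_cancel, div_self hp0.ne', ENNReal.rpow_one]
    have e2 : ∀ y, (K x y ^ ((p - 1) / p)) ^ (p / (p - 1)) = K x y := by
      intro y
      have : p - 1 ≠ 0 := by linarith
      rw [← ENNReal.rpow_mul, div_mul_div_cancel₀ hp0.ne', div_self this, ENNReal.rpow_one]
    have e3 : ∀ y, (K x y ^ (1 / p) * g y) ^ p = K x y * g y ^ p := by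
      intro y
      rw [ENNReal.mul_rpow_of_nonneg _ _ hp0.le, ← ENNReal.rpow_mul, one_div_mul_cancel hp0.ne',
        ENNReal.rpow_one]
    simp only [e1, e2, e3] at h
    have hpp : 1 / (p / (p - 1)) = (p - 1) / p := by rw [one_div_div]
    rw [hpp] at h
    have hq0 : 0 ≤ q := by linarith
    calc (∫⁻ y, K x y * g y ∂ν) ^ q
        ≤ ((∫⁻ y, K x y ∂ν) ^ ((p - 1) / p) * I ^ (1 / p)) ^ q := by gcongr
      _ ≤ (A ^ ((p - 1) / p) * I ^ (1 / p)) ^ q := by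
          have : 0 ≤ (p - 1) / p := by apply div_nonneg <;> linarith
          gcongr
      _ = A ^ ((p - 1) * (q / p)) * I ^ (q / p) := by
          rw [ENNReal.mul_rpow_of_nonneg _ _ hq0, ← ENNReal.rpow_mul, ← ENNReal.rpow_mul]
          congr 2 <;> ring
      _ = A ^ ((p - 1) * (q / p)) * (I ^ (q / p - 1) * I) := by
          congr 1
          conv_rhs => rw [← ENNReal.rpow_one I, ← ENNReal.rpow_mul, one_mul]
          rw [← ENNReal.rpow_add_of_nonneg _ _ (by linarith) (by norm_num), sub_add_cancel]
      _ ≤ A ^ ((p - 1) * (q / p)) * (N ^ (q / p - 1) * I) := by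
          have : 0 ≤ q / p - 1 := by linarith
          gcongr
      _ = _ := by rw [mul_assoc]
  have hI2 : ∫⁻ x, ∫⁻ y, K x y * g y ^ p ∂ν ∂ν ≤ A * N := by
    rw [lintegral_lintegral_swap hKg.aemeasurable, hN, ← lintegral_const_mul _ (hg.pow_const p)]
    apply lintegral_mono_ae
    filter_upwards [hB] with y hy
    have hKy : Measurable fun x => K x y := hK.comp measurable_prodMk_right
    rw [lintegral_mul_const _ hKy]
    gcongr
  calc _ ≤ ∫⁻ x, A ^ ((p - 1) * (q / p)) * N ^ (q / p - 1) * ∫⁻ y, K x y * g y ^ p ∂ν ∂ν :=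
        lintegral_mono_ae key
    _ = A ^ ((p - 1) * (q / p)) * N ^ (q / p - 1) * ∫⁻ x, ∫⁻ y, K x y * g y ^ p ∂ν ∂ν :=
        lintegral_const_mul _ hKg.lintegral_prod_right
    _ ≤ A ^ ((p - 1) * (q / p)) * N ^ (q / p - 1) * (A * N) := by gcongr
    _ = A ^ ((p - 1) * (q / p)) * A * (N ^ (q / p - 1) * N ^ (1 : ℝ)) := by
        rw [ENNReal.rpow_one]; ring
    _ = _ := by
        rw [← ENNReal.rpow_add_of_nonneg _ _ (by linarith) (by norm_num), sub_add_cancel]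

noncomputable def kerK (r s x y : ℝ) : ℝ≥0∞ := ENNReal.ofReal (x ^ r * y ^ s * (x + y) ^ (-(r + s)))

theorem kerK_meas (r s : ℝ) : Measurable (Function.uncurry (kerK r s)) := by
  unfold kerK Function.uncurry
  fun_prop

theorem kerK_symm (r s x y : ℝ) : kerK r s x y = kerK s r y x := by
  unfold kerK
  rw [mul_comm (x ^ r), add_comm x y, add_comm r s]

theorem kerR_le {r s x y : ℝ} (hr : 0 < r) (hs : 0 < s) (hx : 0 < x) (hy : 0 < y) :
    x ^ r * y ^ s * (x + y) ^ (-(r + s)) ≤ x ^ r * y ^ (-r) := by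
  have h0 : (x + y) ^ (-(r + s)) ≤ y ^ (-(r + s)) :=
    Real.rpow_le_rpow_of_nonpos hy (by linarith) (by linarith)
  calc _ ≤ x ^ r * y ^ s * y ^ (-(r + s)) := by gcongr
    _ = _ := by rw [mul_assoc, ← Real.rpow_add hy]; ring_nf

theorem kerR_le' {r s x y : ℝ} (hr : 0 < r) (hs : 0 < s) (hx : 0 < x) (hy : 0 < y) :
    x ^ r * y ^ s * (x + y) ^ (-(r + s)) ≤ x ^ (-s) * y ^ s := by
  have := kerR_le hs hr hy hx
  rw [mul_comm (x ^ r), add_comm x y, add_comm r s, mul_comm (x ^ (-s))]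
  exact this

theorem kerK_le_one {r s x y : ℝ} (hr : 0 < r) (hs : 0 < s) (hx : 0 < x) (hy : 0 < y) :
    kerK r s x y ≤ 1 := by
  unfold kerK
  rw [ENNReal.ofReal_le_one]
  rw [Real.rpow_neg (by positivity), ← div_eq_mul_inv, div_le_one (by positivity),
    Real.rpow_add (by positivity)]
  gcongr <;> linarith

theorem lint_Ioc {s x : ℝ} (hs : 0 < s) (hx : 0 < x) :
    ∫⁻ y in Ioc 0 x, ENNReal.ofReal (y ^ (s - 1)) = ENNReal.ofReal (x ^ s / s) := by
  have hi : IntervalIntegrable (fun y : ℝ => y ^ (s - 1)) volume 0 x :=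
    intervalIntegral.intervalIntegrable_rpow' (by linarith)
  rw [← ofReal_integral_eq_lintegral_ofReal
    ((intervalIntegrable_iff_integrableOn_Ioc_of_le hx.le).1 hi), 
    ← intervalIntegral.integral_of_le hx.le, integral_rpow (Or.inl (by linarith))]
  · rw [sub_add_cancel, Real.zero_rpow hs.ne', sub_zero]
  · filter_upwards [ae_restrict_mem measurableSet_Ioc] with y hy
    exact Real.rpow_nonneg hy.1.le _

theorem lint_Ioi {r x : ℝ} (hr : 0 < r) (hx : 0 < x) :
    ∫⁻ y in Ioi x, ENNReal.ofReal (y ^ (-r - 1)) = ENNReal.ofReal (x ^ (-r) / r) := by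
  rw [← ofReal_integral_eq_lintegral_ofReal
    (integrableOn_Ioi_rpow_of_lt (by linarith) hx), 
    integral_Ioi_rpow_of_lt (by linarith) hx]
  · rw [sub_add_cancel, div_neg, neg_div, neg_neg]
  · filter_upwards [ae_restrict_mem measurableSet_Ioi] with y hy
    exact Real.rpow_nonneg (hx.le.trans (le_of_lt hy)) _

theorem lint_w (a : ℝ) (g : ℝ → ℝ≥0∞) (hg : Measurable g) :
    ∫⁻ y, g y ∂(wMeasure a) = ∫⁻ y in Ioi 0, ENNReal.ofReal (y ^ a) * g y := by
  unfold wMeasure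
  rw [lintegral_withDensity_eq_lintegral_mul _ (by fun_prop) hg]
  rfl

theorem ae_w (a : ℝ) : ∀ᵐ x ∂(wMeasure a), 0 < x := by
  unfold wMeasure
  apply (withDensity_absolutelyContinuous _ _).ae_le
  exact ae_restrict_mem measurableSet_Ioi

theorem kerK_int {r s x : ℝ} (hr : 0 < r) (hs : 0 < s) (hx : 0 < x) :
    ∫⁻ y, kerK r s x y ∂(wMeasure (-1)) ≤ ENNReal.ofReal (1 / s + 1 / r) := by
  have hm : Measurable fun y => kerK r s x y := (kerK_meas r s).comp measurable_prodMk_left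
  rw [lint_w _ _ hm, ← Ioc_union_Ioi_eq_Ioi hx.le,
    lintegral_union measurableSet_Ioi (Ioc_disjoint_Ioi le_rfl), 
    ENNReal.ofReal_add (by positivity) (by positivity)]
  unfold kerK
  gcongr
  · calc _ ≤ ∫⁻ y in Ioc 0 x, ENNReal.ofReal (x ^ (-s)) * ENNReal.ofReal (y ^ (s - 1)) := by
          apply setLIntegral_mono' measurableSet_Ioc
          intro y hy
          have hy0 : 0 < y := hy.1
          rw [← ENNReal.ofReal_mul (by positivity), ← ENNReal.ofReal_mul (by positivity)]
          apply ENNReal.ofReal_le_ofReal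
          calc _ ≤ y ^ (-1 : ℝ) * (x ^ (-s) * y ^ s) := by
                have := kerR_le' hr hs hx hy0
                gcongr
            _ = x ^ (-s) * (y ^ s * y ^ (-1 : ℝ)) := by ring
            _ = _ := by rw [← Real.rpow_add hy0]; rfl
      _ = ENNReal.ofReal (1 / s) := by
          rw [lintegral_const_mul _ (by fun_prop), lint_Ioc hs hx, ← ENNReal.ofReal_mul (by positivity),
            mul_div, ← Real.rpow_add hx, neg_add_cancel, Real.rpow_zero]
      _ ≤ _ := le_rfl
  · calc _ ≤ ∫⁻ y in Ioi x, ENNReal.ofReal (x ^ r) * ENNReal.ofReal (y ^ (-r - 1)) := by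
          apply setLIntegral_mono' measurableSet_Ioi
          intro y hy
          have hy0 : 0 < y := hx.trans hy
          rw [← ENNReal.ofReal_mul (by positivity), ← ENNReal.ofReal_mul (by positivity)]
          apply ENNReal.ofReal_le_ofReal
          calc _ ≤ y ^ (-1 : ℝ) * (x ^ r * y ^ (-r)) := by
                have := kerR_le hr hs hx hy0
                gcongr
            _ = x ^ r * (y ^ (-r) * y ^ (-1 : ℝ)) := by ring
            _ = _ := by rw [← Real.rpow_add hy0]; rfl
      _ = ENNReal.ofReal (1 / r) := by
          rw [lintegral_const_mul _ (by fun_prop), lint_Ioi hr hx, ← ENNReal.ofReal_mul (by positivity),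
            mul_div, ← Real.rpow_add hx, add_neg_cancel, Real.rpow_zero]
      _ ≤ _ := le_rfl

theorem Hop_bound (a b p q α β γ x : ℝ) (f : ℝ → ℝ) (hf : Measurable f) (hx : 0 < x)
    (r s : ℝ) (hr : r = α + (b + 1) / q) (hs : s = β + 1 - (a + 1) / p) (hγ : γ = r + s) :
    ENNReal.ofReal (x ^ ((b + 1) / q)) * ‖Hop α β γ f x‖ₑ
      ≤ ∫⁻ y, kerK r s x y * (‖f y‖ₑ * ENNReal.ofReal (y ^ ((a + 1) / p))) ∂(wMeasure (-1)) := by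
  have hm : Measurable fun y => kerK r s x y := (kerK_meas r s).comp measurable_prodMk_left
  have hm2 : Measurable fun y =>
    kerK r s x y * (‖f y‖ₑ * ENNReal.ofReal (y ^ ((a + 1) / p))) := by fun_prop
  rw [lint_w _ _ hm2]
  unfold Hop
  rw [enorm_mul]
  calc _ ≤ ENNReal.ofReal (x ^ ((b + 1) / q)) * (‖x ^ α‖ₑ *
        ∫⁻ y in Ioi 0, ‖f y * y ^ β / (x + y) ^ γ‖ₑ) := by
        gcongr
        exact enorm_integral_le_lintegral_enorm _
    _ = ∫⁻ y in Ioi 0, ENNReal.ofReal (x ^ ((b + 1) / q)) * (‖x ^ α‖ₑ *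
          ‖f y * y ^ β / (x + y) ^ γ‖ₑ) := by
        rw [lintegral_const_mul, lintegral_const_mul]
        all_goals fun_prop
    _ ≤ _ := by
        apply setLIntegral_mono' measurableSet_Ioi
        intro y hy
        have hy0 : 0 < y := hy
        rw [mul_div_assoc, enorm_mul (f y), Real.enorm_of_nonneg (by positivity : 0 ≤ x ^ α),
          Real.enorm_of_nonneg (by positivity : 0 ≤ y ^ β / (x + y) ^ γ)]
        unfold kerK
        have e : x ^ ((b + 1) / q) * (x ^ α * (y ^ β / (x + y) ^ γ))
            = y ^ (-1 : ℝ) * (x ^ r * y ^ s * (x + y) ^ (-(r + s)) * y ^ ((a + 1) / p)) := by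
          rw [← hγ, Real.rpow_neg (by positivity : 0 ≤ x + y)]
          have h1 : x ^ r = x ^ ((b + 1) / q) * x ^ α := by
            rw [← Real.rpow_add hx, hr, add_comm]
          have h2 : y ^ β = y ^ (-1 : ℝ) * y ^ s * y ^ ((a + 1) / p) := by
            rw [← Real.rpow_add hy0, ← Real.rpow_add hy0, hs]; congr 1; ring
          rw [h1, h2]; ring
        apply le_of_eq
        have e' := congrArg ENNReal.ofReal e
        rw [ENNReal.ofReal_mul (by positivity), ENNReal.ofReal_mul (by positivity),
          ENNReal.ofReal_mul (by positivity), ENNReal.ofReal_mul (by positivity)] at e'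
        calc _ = ‖f y‖ₑ * (ENNReal.ofReal (x ^ ((b + 1) / q)) * (ENNReal.ofReal (x ^ α) *
              ENNReal.ofReal (y ^ β / (x + y) ^ γ))) := by ring
          _ = _ := by rw [e']; ring

theorem weight_eq {b q x : ℝ} (hq : 0 < q) (hx : 0 < x) (u : ℝ≥0∞) :
    ENNReal.ofReal (x ^ (-1 : ℝ)) * (ENNReal.ofReal (x ^ ((b + 1) / q)) * u) ^ q
      = ENNReal.ofReal (x ^ b) * u ^ q := by
  rw [ENNReal.mul_rpow_of_nonneg _ _ hq.le, ← mul_assoc,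
    ENNReal.ofReal_rpow_of_nonneg (by positivity) hq.le, ← ENNReal.ofReal_mul (by positivity),
    ← Real.rpow_mul hx.le, div_mul_cancel₀ _ hq.ne', ← Real.rpow_add hx]
  congr 3; ring

theorem stmt_9 (a b p q α β γ : ℝ) (ha : -1 < a) (hb : -1 < b) (hp : 1 < p) (hpq : p ≤ q)
    (hγ : γ = α + β + 1 - (a + 1) / p + (b + 1) / q)
    (h1 : -p * (γ - β - 1) < a + 1) (h2 : a + 1 < p * (β + 1)) :
    ∃ C : ℝ≥0∞, C ≠ ⊤ ∧ ∀ f : ℝ → ℝ, Measurable f →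
      eLpNorm (Hop α β γ f) (ENNReal.ofReal q) (wMeasure b)
        ≤ C * eLpNorm f (ENNReal.ofReal p) (wMeasure a) := by
  have hp0 : 0 < p := by linarith
  have hq0 : 0 < q := by linarith
  obtain ⟨r, hr⟩ : ∃ r, r = α + (b + 1) / q := ⟨_, rfl⟩
  obtain ⟨s, hs⟩ : ∃ s, s = β + 1 - (a + 1) / p := ⟨_, rfl⟩
  have hrs : γ = r + s := by rw [hγ, hr, hs]; ring
  have hs0 : 0 < s := by
    rw [hs, sub_pos, div_lt_iff₀ hp0]; linarith
  have hr0 : 0 < r := by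
    have : -(γ - β - 1) < (a + 1) / p := by
      rw [lt_div_iff₀ hp0]; linarith
    linarith
  set A : ℝ≥0∞ := ENNReal.ofReal (1 / s + 1 / r) with hA
  have hAt : A ≠ ⊤ := ENNReal.ofReal_ne_top
  refine ⟨(A ^ ((p - 1) * (q / p)) * A) ^ (1 / q), ?_, ?_⟩
  · have : 0 ≤ (p - 1) * (q / p) := mul_nonneg (by linarith) (by positivity)
    exact ENNReal.rpow_ne_top_of_nonneg (by positivity)
      (ENNReal.mul_ne_top (ENNReal.rpow_ne_top_of_nonneg this hAt) hAt)
  intro f hf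
  have : SFinite (wMeasure (-1)) := by unfold wMeasure; infer_instance
  have hg : Measurable fun y => ‖f y‖ₑ * ENNReal.ofReal (y ^ ((a + 1) / p)) :=
    hf.enorm.mul (by fun_prop)
  have main := schur_aux_s9 (wMeasure (-1)) (kerK r s) (kerK_meas r s) A p q hp hpq
    (by filter_upwards [ae_w (-1)] with x hx
        filter_upwards [ae_w (-1)] with y hy
        exact kerK_le_one hr0 hs0 hx hy)
    (by filter_upwards [ae_w (-1)] with x hx
        exact kerK_int hr0 hs0 hx)
    (by filter_upwards [ae_w (-1)] with y hy
        simp_rw [kerK_symm r s]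
        rw [hA, add_comm]
        exact kerK_int hs0 hr0 hy)
    _ hg
  have hN : ∫⁻ y, (‖f y‖ₑ * ENNReal.ofReal (y ^ ((a + 1) / p))) ^ p ∂(wMeasure (-1))
      = ∫⁻ y, ‖f y‖ₑ ^ p ∂(wMeasure a) := by
    rw [lint_w _ _ (hg.pow_const p), lint_w _ _ (hf.enorm.pow_const p)]
    apply setLIntegral_congr_fun measurableSet_Ioi
    intro y hy
    simp only
    rw [mul_comm ‖f y‖ₑ, weight_eq hp0 hy]
  have hL : ∫⁻ x, ‖Hop α β γ f x‖ₑ ^ q ∂(wMeasure b)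
      ≤ ∫⁻ x, (∫⁻ y, kerK r s x y * (‖f y‖ₑ * ENNReal.ofReal (y ^ ((a + 1) / p)))
          ∂(wMeasure (-1))) ^ q ∂(wMeasure (-1)) := by
    rw [lint_w (-1)]
    · refine (lintegral_withDensity_le_lintegral_mul _ (by fun_prop) _).trans ?_
      apply setLIntegral_mono' measurableSet_Ioi
      intro x hx
      simp only [Pi.mul_apply]
      rw [← weight_eq hq0 hx]
      gcongr
      exact Hop_bound a b p q α β γ x f hf hx r s hr hs hrs
    · apply Measurable.pow_const
      exact Measurable.lintegral_prod_right
        (f := fun x y => kerK r s x y * (‖f y‖ₑ * ENNReal.ofReal (y ^ ((a + 1) / p))))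
        ((kerK_meas r s).mul (hg.comp measurable_snd))
  have hp' : ENNReal.ofReal p ≠ 0 := by simpa using hp0
  have hq' : ENNReal.ofReal q ≠ 0 := by simpa using hq0
  rw [eLpNorm_eq_lintegral_rpow_enorm_toReal hp' ENNReal.ofReal_ne_top,
    eLpNorm_eq_lintegral_rpow_enorm_toReal hq' ENNReal.ofReal_ne_top,
    ENNReal.toReal_ofReal hp0.le, ENNReal.toReal_ofReal hq0.le]
  rw [hN] at main
  calc _ ≤ (A ^ ((p - 1) * (q / p)) * A * (∫⁻ y, ‖f y‖ₑ ^ p ∂(wMeasure a)) ^ (q / p)) ^ (1 / q) := by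
        gcongr
        exact hL.trans main
    _ = _ := by
        rw [ENNReal.mul_rpow_of_nonneg _ _ (by positivity), ← ENNReal.rpow_mul]
        congr 2
        field_simp
end

section
/- Let 1 < p < ∞ and a > -1. Assume -pα < a+1 < p(β+1) and γ = α + β + 1. Then the operator norm of H_{α,β,γ} on L^p((0,∞), x^a dx) equals B(β + 1 - (a+1)/p, α + (a+1)/p). -/
open MeasureTheory Set ENNReal

/-- The Euler Beta function in the form `B(m,n) = ∫₀^∞ u^(m-1)/(1+u)^(m+n) du`. -/
noncomputable def Beta (m n : ℝ) : ℝ := ∫ u in Ioi (0:ℝ), u ^ (m - 1) / (1 + u) ^ (m + n)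

noncomputable def KK (m n : ℝ) (u : ℝ) : ℝ≥0∞ := ENNReal.ofReal (u ^ (m - 1) / (1 + u) ^ (m + n))

noncomputable def nuM (m n : ℝ) : Measure ℝ := (volume.restrict (Ioi (0:ℝ))).withDensity (KK m n)

lemma KK_meas (m n : ℝ) : Measurable (KK m n) := by
  unfold KK; fun_prop

lemma nuM_lintegral (m n : ℝ) (g : ℝ → ℝ≥0∞) :
    ∫⁻ u, g u ∂(nuM m n) = ∫⁻ u in Ioi (0:ℝ), KK m n u * g u := by
  unfold nuM
  rw [lintegral_withDensity_eq_lintegral_mul_non_measurable _ (KK_meas m n)]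
  · rfl
  · exact Filter.Eventually.of_forall fun x => ENNReal.ofReal_lt_top

lemma w_lintegral (a : ℝ) (g : ℝ → ℝ≥0∞) :
    ∫⁻ u, g u ∂(wMeasure a) = ∫⁻ u in Ioi (0:ℝ), ENNReal.ofReal (u ^ a) * g u := by
  unfold wMeasure
  rw [lintegral_withDensity_eq_lintegral_mul_non_measurable _ (by fun_prop)]
  · rfl
  · exact Filter.Eventually.of_forall fun x => ENNReal.ofReal_lt_top

lemma scale_lintegral {x : ℝ} (hx : 0 < x) (g : ℝ → ℝ≥0∞) :
    ∫⁻ y in Ioi (0:ℝ), g y = ∫⁻ u in Ioi (0:ℝ), ENNReal.ofReal x * g (x * u) := by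
  have h := lintegral_image_eq_lintegral_abs_deriv_mul (s := Ioi (0:ℝ)) (f := fun u => x * u)
    (f' := fun _ => x) measurableSet_Ioi
    (fun u _ => by simpa using ((hasDerivAt_id u).const_mul x).hasDerivWithinAt)
    (fun u _ v _ huv => mul_left_cancel₀ hx.ne' huv) g
  have him : (fun u => x * u) '' Ioi (0:ℝ) = Ioi 0 := by
    ext y; constructor
    · rintro ⟨u, hu, rfl⟩; exact mul_pos hx hu
    · intro hy; exact ⟨y / x, div_pos hy hx, by field_simp⟩
  rw [him, abs_of_pos hx] at h
  exact h

lemma key_real {x u m n s : ℝ} (hx : 0 < x) (hu : 0 < u) :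
    x * (x ^ (n - s) * ((x * u) ^ (m - 1 + s) / (x + x * u) ^ (m + n)))
      = u ^ (m - 1) / (1 + u) ^ (m + n) * u ^ s := by
  have h1 : x + x * u = x * (1 + u) := by ring
  rw [h1, Real.mul_rpow hx.le hu.le, Real.mul_rpow hx.le (by positivity), Real.rpow_add hu]
  have h2 : x ^ (m + n) = x * x ^ (n - s) * x ^ (m - 1 + s) := by
    nth_rewrite 2 [← Real.rpow_one x]
    rw [← Real.rpow_add hx, ← Real.rpow_add hx]; congr 1; ring
  rw [h2]
  have := (Real.rpow_pos_of_pos hx (n - s)).ne'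
  have := (Real.rpow_pos_of_pos hx (m - 1 + s)).ne'
  have : (1 + u) ^ (m + n) ≠ 0 := (Real.rpow_pos_of_pos (by linarith) _).ne'
  field_simp

lemma key_lint (m n s : ℝ) (f : ℝ → ℝ) {x : ℝ} (hx : 0 < x) :
    ENNReal.ofReal (x ^ (n - s)) *
      ∫⁻ y in Ioi (0:ℝ), ‖f y * y ^ (m - 1 + s) / (x + y) ^ (m + n)‖ₑ
      = ∫⁻ u, ‖f (x * u)‖ₑ * ENNReal.ofReal (u ^ s) ∂(nuM m n) := by
  rw [nuM_lintegral, ← lintegral_const_mul' _ _ ENNReal.ofReal_ne_top, scale_lintegral hx]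
  refine setLIntegral_congr_fun measurableSet_Ioi fun u hu => ?_
  have hu : 0 < u := hu
  have hc : 0 ≤ (x * u) ^ (m - 1 + s) / (x + x * u) ^ (m + n) := by positivity
  beta_reduce
  rw [mul_div_assoc, enorm_mul, Real.enorm_of_nonneg hc, KK]
  calc _ = ‖f (x * u)‖ₑ * ENNReal.ofReal (x * (x ^ (n - s) *
            ((x * u) ^ (m - 1 + s) / (x + x * u) ^ (m + n)))) := by
        rw [ENNReal.ofReal_mul hx.le, ENNReal.ofReal_mul (by positivity)]; ring
    _ = _ := by
        rw [key_real hx hu, ENNReal.ofReal_mul (by positivity)]; ring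

lemma beta_integrable {m n : ℝ} (hm : 0 < m) (hn : 0 < n) :
    IntegrableOn (fun u : ℝ => u ^ (m - 1) / (1 + u) ^ (m + n)) (Ioi 0) := by
  rw [← Ioc_union_Ioi_eq_Ioi (zero_le_one' ℝ)]
  have hmeas : Measurable (fun u : ℝ => u ^ (m - 1) / (1 + u) ^ (m + n)) := by fun_prop
  refine IntegrableOn.union ?_ ?_
  · have h : IntegrableOn (fun u : ℝ => u ^ (m - 1)) (Ioc 0 1) := by
      rw [← intervalIntegrable_iff_integrableOn_Ioc_of_le zero_le_one]
      exact intervalIntegral.intervalIntegrable_rpow' (by linarith)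
    refine Integrable.mono' h hmeas.aestronglyMeasurable ?_
    refine (ae_restrict_iff' measurableSet_Ioc).2 (Filter.Eventually.of_forall fun u hu => ?_)
    have hu0 : 0 < u := hu.1
    rw [Real.norm_of_nonneg (by positivity)]
    exact div_le_self (by positivity) (Real.one_le_rpow (by linarith) (by linarith))
  · have h : IntegrableOn (fun u : ℝ => u ^ (- n - 1)) (Ioi 1) :=
      integrableOn_Ioi_rpow_of_lt (by linarith) one_pos
    refine Integrable.mono' h hmeas.aestronglyMeasurable ?_
    refine (ae_restrict_iff' measurableSet_Ioi).2 (Filter.Eventually.of_forall fun u hu => ?_)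
    have hu0 : 0 < u := lt_trans one_pos hu
    rw [Real.norm_of_nonneg (by positivity), div_le_iff₀ (by positivity)]
    have h3 : u ^ (m - 1) = u ^ (-n - 1) * u ^ (m + n) := by
      rw [← Real.rpow_add hu0]; congr 1; ring
    rw [h3]
    gcongr
    linarith

lemma nuM_univ {m n : ℝ} (hm : 0 < m) (hn : 0 < n) :
    nuM m n univ = ENNReal.ofReal (Beta m n) := by
  have h := nuM_lintegral m n (fun _ => 1)
  simp only [lintegral_one, mul_one] at h
  rw [h, Beta, ofReal_integral_eq_lintegral_ofReal (beta_integrable hm hn)]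
  · rfl
  · refine (ae_restrict_iff' measurableSet_Ioi).2 (Filter.Eventually.of_forall fun u hu => ?_)
    have hu : 0 < u := hu
    simp only [Pi.zero_apply]; positivity

lemma holder_one {μ : Measure ℝ} {p : ℝ} (hp : 1 < p) {g : ℝ → ℝ≥0∞} (hg : Measurable g) :
    (∫⁻ u, g u ∂μ) ^ p ≤ μ univ ^ (p - 1) * ∫⁻ u, g u ^ p ∂μ := by
  have hpq := Real.HolderConjugate.conjExponent hp
  have h := ENNReal.lintegral_mul_le_Lp_mul_Lq μ hpq hg.aemeasurable
    (g := fun _ => 1) aemeasurable_const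
  simp only [Pi.mul_apply, mul_one, ENNReal.one_rpow, lintegral_one] at h
  calc _ ≤ ((∫⁻ u, g u ^ p ∂μ) ^ (1 / p) * μ univ ^ (1 / p.conjExponent)) ^ p := by gcongr
    _ = _ := by
      rw [ENNReal.mul_rpow_of_nonneg _ _ (by linarith), ← ENNReal.rpow_mul, ← ENNReal.rpow_mul,
        one_div_mul_cancel (by linarith), ENNReal.rpow_one, mul_comm]
      congr 2
      rw [Real.conjExponent]
      have : p - 1 ≠ 0 := by linarith
      have : p ≠ 0 := by linarith
      field_simp

lemma scale_norm {a p s : ℝ} (hp : 1 < p) (hs : s * p = a + 1) (f : ℝ → ℝ) {u : ℝ} (hu : 0 < u) :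
    ∫⁻ x in Ioi (0:ℝ), ENNReal.ofReal (x ^ a) * (‖f (x * u)‖ₑ * ENNReal.ofReal (u ^ s)) ^ p
      = ∫⁻ x in Ioi (0:ℝ), ENNReal.ofReal (x ^ a) * ‖f x‖ₑ ^ p := by
  rw [scale_lintegral hu (fun x => ENNReal.ofReal (x ^ a) * ‖f x‖ₑ ^ p)]
  refine setLIntegral_congr_fun measurableSet_Ioi fun x hx => ?_
  have hx : 0 < x := hx
  beta_reduce
  rw [ENNReal.mul_rpow_of_nonneg _ _ (by linarith), ENNReal.ofReal_rpow_of_pos (by positivity),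
    ← Real.rpow_mul hu.le, hs, Real.mul_rpow hu.le hx.le, ENNReal.ofReal_mul (by positivity),
    Real.rpow_add hu, Real.rpow_one, ENNReal.ofReal_mul (by positivity), mul_comm x u]
  ring

lemma hop_le (m n s : ℝ) (f : ℝ → ℝ) {x : ℝ} (hx : 0 < x) :
    ‖Hop (n - s) (m - 1 + s) (m + n) f x‖ₑ
      ≤ ∫⁻ u, ‖f (x * u)‖ₑ * ENNReal.ofReal (u ^ s) ∂(nuM m n) := by
  rw [← key_lint m n s f hx, Hop, enorm_mul, Real.enorm_of_nonneg (by positivity)]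
  gcongr
  exact enorm_integral_le_lintegral_enorm _

instance (m n : ℝ) : SFinite (nuM m n) := by unfold nuM; infer_instance

lemma upper_pow {a p m n s : ℝ} (hm : 0 < m) (hn : 0 < n) (hp : 1 < p) (hs : s * p = a + 1)
    (f : ℝ → ℝ) (hf : Measurable f) :
    ∫⁻ x, ‖Hop (n - s) (m - 1 + s) (m + n) f x‖ₑ ^ p ∂(wMeasure a)
      ≤ ENNReal.ofReal (Beta m n) ^ p * ∫⁻ x, ‖f x‖ₑ ^ p ∂(wMeasure a) := by
  rw [w_lintegral, w_lintegral]
  set B := ENNReal.ofReal (Beta m n) with hB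
  have hBp : B ^ p = B ^ (p - 1) * B := by
    nth_rewrite 3 [← ENNReal.rpow_one B]
    rw [← ENNReal.rpow_add_of_nonneg _ _ (by linarith) (by norm_num)]; congr 1; ring
  calc _ ≤ ∫⁻ x in Ioi (0:ℝ), B ^ (p - 1) * ∫⁻ u, ENNReal.ofReal (x ^ a) *
          (‖f (x * u)‖ₑ * ENNReal.ofReal (u ^ s)) ^ p ∂(nuM m n) := by
        refine setLIntegral_mono' measurableSet_Ioi fun x hx => ?_
        have hx : 0 < x := hx
        rw [lintegral_const_mul' _ _ ENNReal.ofReal_ne_top]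
        calc _ ≤ ENNReal.ofReal (x ^ a) * (B ^ (p - 1) *
              ∫⁻ u, (‖f (x * u)‖ₑ * ENNReal.ofReal (u ^ s)) ^ p ∂(nuM m n)) := by
              gcongr
              refine le_trans (ENNReal.rpow_le_rpow (hop_le m n s f hx) (by linarith)) ?_
              rw [hB, ← nuM_univ hm hn]
              exact holder_one hp (by fun_prop)
          _ = _ := by ring
    _ = B ^ (p - 1) * ∫⁻ x in Ioi (0:ℝ), ∫⁻ u, ENNReal.ofReal (x ^ a) *
          (‖f (x * u)‖ₑ * ENNReal.ofReal (u ^ s)) ^ p ∂(nuM m n) :=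
        lintegral_const_mul' _ _ (ENNReal.rpow_ne_top_of_nonneg (by linarith) ENNReal.ofReal_ne_top)
    _ = B ^ (p - 1) * ∫⁻ u, (∫⁻ x in Ioi (0:ℝ), ENNReal.ofReal (x ^ a) *
          (‖f (x * u)‖ₑ * ENNReal.ofReal (u ^ s)) ^ p) ∂(nuM m n) := by
        rw [lintegral_lintegral_swap]
        apply Measurable.aemeasurable
        unfold Function.uncurry
        fun_prop
    _ = B ^ (p - 1) * (B * ∫⁻ x in Ioi (0:ℝ), ENNReal.ofReal (x ^ a) * ‖f x‖ₑ ^ p) := by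
        congr 1
        rw [nuM_lintegral, hB, ← nuM_univ hm hn, mul_comm, ← lintegral_const, nuM_lintegral]
        refine setLIntegral_congr_fun measurableSet_Ioi fun u hu => ?_
        beta_reduce
        rw [scale_norm hp hs f hu]
    _ = _ := by rw [hBp, mul_assoc]

lemma eLp_eq {p : ℝ} (hp : 1 < p) (μ : Measure ℝ) (f : ℝ → ℝ) :
    eLpNorm f (ENNReal.ofReal p) μ = (∫⁻ x, ‖f x‖ₑ ^ p ∂μ) ^ (1 / p) := by
  rw [eLpNorm_eq_lintegral_rpow_enorm_toReal (by simpa using by linarith) ENNReal.ofReal_ne_top,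
    ENNReal.toReal_ofReal (by linarith)]

lemma eLp_pow {p : ℝ} (hp : 1 < p) (μ : Measure ℝ) (f g : ℝ → ℝ) (C : ℝ≥0∞) :
    eLpNorm f (ENNReal.ofReal p) μ ≤ C * eLpNorm g (ENNReal.ofReal p) μ ↔
    ∫⁻ x, ‖f x‖ₑ ^ p ∂μ ≤ C ^ p * ∫⁻ x, ‖g x‖ₑ ^ p ∂μ := by
  have hp0 : 0 < p := by linarith
  rw [eLp_eq hp, eLp_eq hp, ← ENNReal.rpow_le_rpow_iff hp0,
    ENNReal.mul_rpow_of_nonneg _ _ hp0.le, ← ENNReal.rpow_mul, ← ENNReal.rpow_mul,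
    one_div_mul_cancel hp0.ne', ENNReal.rpow_one, ENNReal.rpow_one]

lemma log_lint {c d : ℝ} (hc : 0 < c) (hcd : c ≤ d) :
    ∫⁻ x in Icc c d, ENNReal.ofReal (x⁻¹) = ENNReal.ofReal (Real.log (d / c)) := by
  rw [← integral_inv_of_pos hc (hc.trans_le hcd), intervalIntegral.integral_of_le hcd,
    ← integral_Icc_eq_integral_Ioc, ofReal_integral_eq_lintegral_ofReal]
  · refine ContinuousOn.integrableOn_Icc ?_
    exact continuousOn_inv₀.mono fun x hx => (hc.trans_le hx.1).ne'
  · refine (ae_restrict_iff' measurableSet_Icc).2 (Filter.Eventually.of_forall fun u hu => ?_)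
    exact inv_nonneg.2 (hc.le.trans hu.1)

/-- test function -/
noncomputable def tf (s N : ℝ) : ℝ → ℝ := (Icc 1 N).indicator (fun x => x ^ (-s))

lemma tf_meas (s N : ℝ) : Measurable (tf s N) :=
  Measurable.indicator (by fun_prop) measurableSet_Icc

lemma tf_nonneg (s N x : ℝ) : 0 ≤ tf s N x :=
  indicator_nonneg (fun x hx => Real.rpow_nonneg (zero_le_one.trans hx.1) _) _

lemma tf_le (s N : ℝ) {x : ℝ} (hx : 0 < x) : tf s N x ≤ x ^ (-s) :=
  indicator_le_self' (fun _ _ => Real.rpow_nonneg hx.le _) _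

lemma pow_id {a p s x : ℝ} (hs : s * p = a + 1) (hx : 0 < x) :
    ENNReal.ofReal (x ^ a) * ENNReal.ofReal (x ^ (-s)) ^ p = ENNReal.ofReal (x⁻¹) := by
  rw [ENNReal.ofReal_rpow_of_pos (by positivity), ← ENNReal.ofReal_mul (by positivity),
    ← Real.rpow_mul hx.le, ← Real.rpow_add hx, ← Real.rpow_neg_one]
  congr 2; linarith

lemma tf_norm {a p s N : ℝ} (hp : 1 < p) (hs : s * p = a + 1) (hN : 1 ≤ N) :
    ∫⁻ x, ‖tf s N x‖ₑ ^ p ∂(wMeasure a) = ENNReal.ofReal (Real.log N) := by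
  have hp0 : 0 < p := by linarith
  have h := log_lint one_pos hN
  rw [div_one] at h
  rw [w_lintegral, ← h, ← lintegral_indicator measurableSet_Ioi,
    ← lintegral_indicator measurableSet_Icc]
  congr 1; ext x
  by_cases hx : x ∈ Icc 1 N
  · have hx0 : 0 < x := one_pos.trans_le hx.1
    rw [indicator_of_mem (show x ∈ Ioi (0:ℝ) from hx0), indicator_of_mem hx, tf,
      indicator_of_mem hx, Real.enorm_of_nonneg (by positivity), pow_id hs hx0]
  · rw [indicator_of_notMem hx, tf]
    simp [indicator_of_notMem hx, hp0]

lemma tf_bound (m n s N : ℝ) {x : ℝ} (hx : 0 < x) :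
    ∫⁻ u, ‖tf s N (x * u)‖ₑ * ENNReal.ofReal (u ^ s) ∂(nuM m n)
      ≤ ENNReal.ofReal (x ^ (-s)) * nuM m n univ := by
  rw [← lintegral_const, nuM_lintegral, nuM_lintegral]
  refine setLIntegral_mono' measurableSet_Ioi fun u hu => ?_
  have hu : 0 < u := hu
  gcongr
  rw [Real.enorm_of_nonneg (tf_nonneg _ _ _), ← ENNReal.ofReal_mul (tf_nonneg _ _ _)]
  apply ENNReal.ofReal_le_ofReal
  calc _ ≤ (x * u) ^ (-s) * u ^ s := by
        gcongr; exact tf_le _ _ (by positivity)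
    _ = _ := by
      rw [Real.mul_rpow hx.le hu.le, mul_assoc, ← Real.rpow_add hu]; simp

lemma tf_hop {m n : ℝ} (hm : 0 < m) (hn : 0 < n) (s N : ℝ) {x : ℝ} (hx : 0 < x) :
    ‖Hop (n - s) (m - 1 + s) (m + n) (tf s N) x‖ₑ
      = ∫⁻ u, ‖tf s N (x * u)‖ₑ * ENNReal.ofReal (u ^ s) ∂(nuM m n) := by
  have hk := key_lint m n s (tf s N) hx
  have hb := tf_bound m n s N hx
  rw [← hk] at hb ⊢
  have hpos : ∀ y ∈ Ioi (0:ℝ), 0 ≤ tf s N y * y ^ (m - 1 + s) / (x + y) ^ (m + n) := by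
    intro y hy
    have hy : 0 < y := hy
    have := tf_nonneg s N y
    positivity
  have hfin : ∫⁻ y in Ioi (0:ℝ), ‖tf s N y * y ^ (m - 1 + s) / (x + y) ^ (m + n)‖ₑ < ⊤ := by
    by_contra hcon
    rw [not_lt, top_le_iff] at hcon
    rw [hcon, ENNReal.mul_top (by simpa using Real.rpow_pos_of_pos hx _), nuM_univ hm hn] at hb
    exact (ENNReal.mul_lt_top ENNReal.ofReal_lt_top ENNReal.ofReal_lt_top).not_ge hb
  have hint : IntegrableOn (fun y => tf s N y * y ^ (m - 1 + s) / (x + y) ^ (m + n)) (Ioi 0) := by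
    refine ⟨Measurable.aestronglyMeasurable ?_, hfin⟩
    have := tf_meas s N
    fun_prop
  rw [Hop, enorm_mul, Real.enorm_of_nonneg (by positivity)]
  congr 1
  rw [Real.enorm_of_nonneg (setIntegral_nonneg measurableSet_Ioi hpos),
    ofReal_integral_eq_lintegral_ofReal hint
      ((ae_restrict_iff' measurableSet_Ioi).2 (Filter.Eventually.of_forall hpos))]
  refine setLIntegral_congr_fun measurableSet_Ioi fun y hy => ?_
  beta_reduce
  rw [Real.enorm_of_nonneg (hpos y hy)]

lemma tf_hop_ge {m n : ℝ} (hm : 0 < m) (hn : 0 < n) {s N R x : ℝ} (hR : 1 < R)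
    (hx1 : R ≤ x) (hx2 : x ≤ N / R) :
    ENNReal.ofReal (x ^ (-s)) * nuM m n (Icc R⁻¹ R)
      ≤ ‖Hop (n - s) (m - 1 + s) (m + n) (tf s N) x‖ₑ := by
  have hR0 : 0 < R := by linarith
  have hx : 0 < x := by linarith
  rw [tf_hop hm hn s N hx, ← setLIntegral_const]
  refine le_trans ?_ (setLIntegral_le_lintegral (Icc R⁻¹ R) _)
  refine setLIntegral_mono' measurableSet_Icc fun u hu => ?_
  have hu0 : 0 < u := (inv_pos.2 hR0).trans_le hu.1
  have hmem : x * u ∈ Icc 1 N := by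
    constructor
    · calc (1:ℝ) = R * R⁻¹ := by field_simp
        _ ≤ x * u := by gcongr; exact hu.1
    · calc x * u ≤ N / R * R := by
            gcongr
            · exact hx.le.trans hx2
            · exact hu.2
        _ = N := by field_simp
  rw [Real.enorm_of_nonneg (tf_nonneg _ _ _), ← ENNReal.ofReal_mul (tf_nonneg _ _ _), tf,
    indicator_of_mem hmem, Real.mul_rpow hx.le hu0.le, mul_assoc, ← Real.rpow_add hu0]
  simp

lemma lower_R {a p m n s R : ℝ} (hm : 0 < m) (hn : 0 < n) (hp : 1 < p) (hs : s * p = a + 1)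
    (hR : 1 < R) (k : ℕ) (C : ℝ≥0∞)
    (hC : ∀ f : ℝ → ℝ, Measurable f →
      ∫⁻ x, ‖Hop (n - s) (m - 1 + s) (m + n) f x‖ₑ ^ p ∂(wMeasure a)
        ≤ C ^ p * ∫⁻ x, ‖f x‖ₑ ^ p ∂(wMeasure a)) :
    nuM m n (Icc R⁻¹ R) ^ p * ENNReal.ofReal (k * Real.log R)
      ≤ C ^ p * ENNReal.ofReal ((k + 2 : ℝ) * Real.log R) := by
  have hR0 : 0 < R := by linarith
  have hp0 : 0 < p := by linarith
  have h := hC (tf s (R ^ (k + 2))) (tf_meas _ _)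
  rw [tf_norm hp hs (one_le_pow₀ hR.le), Real.log_pow] at h
  push_cast at h
  refine le_trans ?_ h
  have hle : R ≤ R ^ (k + 1) := le_self_pow₀ hR.le (by simp)
  have hlog := log_lint hR0 hle
  have e1 : R ^ (k + 1) / R = R ^ k := by rw [pow_succ]; field_simp
  rw [e1, Real.log_pow] at hlog
  rw [← hlog, w_lintegral]
  have hfin : nuM m n (Icc R⁻¹ R) ≠ ⊤ := by
    refine ((measure_mono (subset_univ _)).trans_lt ?_).ne
    rw [nuM_univ hm hn]; exact ENNReal.ofReal_lt_top
  rw [← lintegral_const_mul' _ _ (ENNReal.rpow_ne_top_of_nonneg hp0.le hfin)]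
  refine le_trans ?_ (lintegral_mono_set (s := Icc R (R ^ (k + 1))) 
    (fun x hx => hR0.trans_le hx.1))
  refine setLIntegral_mono' measurableSet_Icc fun x hx => ?_
  have hx0 : 0 < x := hR0.trans_le hx.1
  have hg := tf_hop_ge hm hn (s := s) (N := R ^ (k + 2)) hR hx.1
    (by rw [le_div_iff₀ hR0, pow_succ]; gcongr; exact hx.2)
  calc _ = ENNReal.ofReal (x ^ a) *
        (ENNReal.ofReal (x ^ (-s)) * nuM m n (Icc R⁻¹ R)) ^ p := by
        rw [ENNReal.mul_rpow_of_nonneg _ _ hp0.le, ← pow_id hs hx0]; ring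
    _ ≤ _ := by gcongr

lemma lim_arg {b c L : ℝ} (hL : 0 < L)
    (h : ∀ k : ℕ, b * (k * L) ≤ c * ((k + 2) * L)) : b ≤ c := by
  by_contra hcon
  push Not at hcon
  obtain ⟨k, hk⟩ := exists_nat_gt (2 * c / (b - c))
  rw [div_lt_iff₀ (by linarith)] at hk
  have := h k
  have h2 : (b * k) * L ≤ (c * (k + 2)) * L := by linarith
  have := le_of_mul_le_mul_right h2 hL
  linarith

lemma lower_R' {a p m n s R : ℝ} (hm : 0 < m) (hn : 0 < n) (hp : 1 < p) (hs : s * p = a + 1)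
    (hR : 1 < R) (C : ℝ≥0∞)
    (hC : ∀ f : ℝ → ℝ, Measurable f →
      ∫⁻ x, ‖Hop (n - s) (m - 1 + s) (m + n) f x‖ₑ ^ p ∂(wMeasure a)
        ≤ C ^ p * ∫⁻ x, ‖f x‖ₑ ^ p ∂(wMeasure a)) :
    nuM m n (Icc R⁻¹ R) ≤ C := by
  have hp0 : 0 < p := by linarith
  by_cases hCt : C = ⊤
  · simp [hCt]
  have hfin : nuM m n (Icc R⁻¹ R) ≠ ⊤ := by
    refine ((measure_mono (subset_univ _)).trans_lt ?_).ne
    rw [nuM_univ hm hn]; exact ENNReal.ofReal_lt_top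
  rw [← ENNReal.rpow_le_rpow_iff hp0]
  have hC' := ENNReal.rpow_ne_top_of_nonneg hp0.le hCt
  have hb' := ENNReal.rpow_ne_top_of_nonneg hp0.le hfin
  rw [← ENNReal.toReal_le_toReal hb' hC']
  have hL := Real.log_pos hR
  refine lim_arg hL fun k => ?_
  have h := lower_R hm hn hp hs hR k C hC
  have h2 := ENNReal.toReal_mono (ENNReal.mul_ne_top hC' ENNReal.ofReal_ne_top) h
  rw [ENNReal.toReal_mul, ENNReal.toReal_mul, ENNReal.toReal_ofReal (by positivity),
    ENNReal.toReal_ofReal (by positivity)] at h2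
  exact h2

lemma lower {a p m n s : ℝ} (hm : 0 < m) (hn : 0 < n) (hp : 1 < p) (hs : s * p = a + 1)
    (C : ℝ≥0∞)
    (hC : ∀ f : ℝ → ℝ, Measurable f →
      ∫⁻ x, ‖Hop (n - s) (m - 1 + s) (m + n) f x‖ₑ ^ p ∂(wMeasure a)
        ≤ C ^ p * ∫⁻ x, ‖f x‖ₑ ^ p ∂(wMeasure a)) :
    ENNReal.ofReal (Beta m n) ≤ C := by
  have h0 : nuM m n univ = nuM m n (Ioi 0) := by
    have : nuM m n (Ioi 0)ᶜ = 0 := by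
      unfold nuM
      apply withDensity_absolutelyContinuous
      rw [Measure.restrict_apply measurableSet_Ioi.compl, compl_inter_self, measure_empty]
    rw [← measure_add_measure_compl (measurableSet_Ioi (a := (0:ℝ))), this, add_zero]
  have hU : (⋃ k : ℕ, Icc ((k + 2 : ℝ)⁻¹) (k + 2 : ℝ)) = Ioi (0:ℝ) := by
    ext x
    simp only [mem_iUnion, mem_Icc, mem_Ioi]
    constructor
    · rintro ⟨k, hk, _⟩
      exact lt_of_lt_of_le (by positivity) hk
    · intro hx
      obtain ⟨k, hk⟩ := exists_nat_gt (max x x⁻¹)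
      refine ⟨k, ?_, ?_⟩
      · rw [inv_le_comm₀ (by positivity) hx]
        have := (le_max_right x x⁻¹).trans hk.le
        linarith
      · have := (le_max_left x x⁻¹).trans hk.le
        linarith
  rw [← nuM_univ hm hn, h0, ← hU, Monotone.measure_iUnion]
  · refine iSup_le fun k => lower_R' hm hn hp hs ?_ C hC
    have : (0:ℝ) ≤ k := k.cast_nonneg
    linarith
  · intro i j hij
    have : (i:ℝ) ≤ j := by exact_mod_cast hij
    apply Icc_subset_Icc
    · gcongr
    · gcongr

theorem stmt_13 (a p α β γ : ℝ) (hp : 1 < p) (ha : -1 < a)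
    (h1 : -p * α < a + 1) (h2 : a + 1 < p * (β + 1)) (hγ : γ = α + β + 1) :
    sInf {C : ℝ≥0∞ | ∀ f : ℝ → ℝ, Measurable f →
        eLpNorm (Hop α β γ f) (ENNReal.ofReal p) (wMeasure a)
          ≤ C * eLpNorm f (ENNReal.ofReal p) (wMeasure a)}
      = ENNReal.ofReal (Beta (β + 1 - (a + 1) / p) (α + (a + 1) / p)) := by
  have hp0 : 0 < p := by linarith
  obtain ⟨s, hsdef⟩ : ∃ s, s = (a + 1) / p := ⟨_, rfl⟩
  have hs : s * p = a + 1 := by rw [hsdef]; field_simp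
  obtain ⟨m, hmdef⟩ : ∃ m, m = β + 1 - s := ⟨_, rfl⟩
  obtain ⟨n, hndef⟩ : ∃ n, n = α + s := ⟨_, rfl⟩
  have hm : 0 < m := by
    rw [hmdef, hsdef, sub_pos, div_lt_iff₀ hp0]; linarith
  have hn : 0 < n := by
    have : -α < s := by rw [hsdef, lt_div_iff₀ hp0]; linarith
    linarith
  have eα : α = n - s := by linarith
  have eβ : β = m - 1 + s := by linarith
  have eγ : γ = m + n := by linarith
  rw [← hsdef, ← hmdef, ← hndef, eα, eβ, eγ]
  simp only [eLp_pow hp]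
  apply le_antisymm
  · exact sInf_le fun f hf => upper_pow hm hn hp hs f hf
  · exact le_sInf fun C hC => lower hm hn hp hs C hC
end
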